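/- Let u = (u₁,u₂), v = (v₁,v₂) ∈ ℝ² be constant unit vectors with u₁ < 0, u₂ > 0, v₁ > 0, v₂ > 0 and u₁ + v₁ ≠ 0. Let f̃ ∈ C^∞(ℝ) ∩ L¹(ℝ) and let f(x,y) = f̃(x) on ℝ²₊. Then for every x ∈ ℝ, f̃(x) = −(u₁v₁/(u₁+v₁))·∂_x Rf(x,0). -/

import Mathlib

open MeasureTheory Set

/-- Integrating `g` along the ray from `y` with positive speed `a` rescales its integral over
`(y, ∞)`. -/
theorem setIntegral_Ioi_comp_add_mul (g : ℝ → ℝ) {a : ℝ} (ha : 0 < a) (y : ℝ) :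
    ∫ t in Ioi (0 : ℝ), g (y + t * a) = a⁻¹ * ∫ s in Ioi y, g s := by
  have hscale := integral_comp_mul_right_Ioi (fun s => g (y + s)) 0 ha
  have htranslate := (measurePreserving_add_left volume y).setIntegral_preimage_emb
    (measurableEmbedding_addLeft y) g (Ioi y)
  simp only [preimage_const_add_Ioi, sub_self] at htranslate
  rw [hscale, zero_mul, htranslate, smul_eq_mul]

theorem hasDerivAt_setIntegral_Ioi {g : ℝ → ℝ} (hg : Continuous g) (hint : Integrable g) (x : ℝ) :
    HasDerivAt (fun y => ∫ s in Ioi y, g s) (-g x) x := by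
  have heq : (fun y => ∫ s in Ioi y, g s) =
      fun y => (∫ s in Ioi (0 : ℝ), g s) - ∫ s in (0 : ℝ)..y, g s := by
    funext y
    rw [← intervalIntegral.integral_interval_add_Ioi (a := 0) (b := y) hint.integrableOn
      hint.integrableOn, add_sub_cancel_left]
  rw [heq]
  exact (hg.integral_hasStrictDerivAt 0 x).hasDerivAt.const_sub _

theorem hasDerivAt_rayIntegral_of_pos {g : ℝ → ℝ} (hg : Continuous g) (hint : Integrable g)
    {a : ℝ} (ha : 0 < a) (x : ℝ) :
    HasDerivAt (fun y => ∫ t in Ioi (0 : ℝ), g (y + t * a)) (a⁻¹ * -g x) x := by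
  simp only [setIntegral_Ioi_comp_add_mul g ha]
  exact (hasDerivAt_setIntegral_Ioi hg hint x).const_mul _

theorem hasDerivAt_rayIntegral_of_neg {g : ℝ → ℝ} (hg : Continuous g) (hint : Integrable g)
    {a : ℝ} (ha : a < 0) (x : ℝ) :
    HasDerivAt (fun y => ∫ t in Ioi (0 : ℝ), g (y + t * a)) (a⁻¹ * -g x) x := by
  have h := (hasDerivAt_rayIntegral_of_pos (hg.comp continuous_neg) hint.comp_neg
    (neg_pos.2 ha) (-x)).comp x (hasDerivAt_neg x)
  simpa [Function.comp_def, inv_neg, add_comm] using h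

/-- Inversion formula via the x-derivative for constant direction vectors. -/
theorem stmt_2
    (u1 u2 v1 v2 : ℝ)
    (hu_unit : u1 ^ 2 + u2 ^ 2 = 1) (hv_unit : v1 ^ 2 + v2 ^ 2 = 1)
    (hu1_neg : u1 < 0) (hu2_pos : 0 < u2)
    (hv1_pos : 0 < v1) (hv2_pos : 0 < v2)
    (hsum : u1 + v1 ≠ 0)
    (ftil : ℝ → ℝ) (hftil_smooth : ContDiff ℝ (⊤ : ℕ∞) ftil) (hftil_int : Integrable ftil)
    (f : ℝ × ℝ → ℝ) (hf : ∀ x y : ℝ, 0 ≤ y → f (x, y) = ftil x)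
    (R : ℝ → ℝ → ℝ)
    (hR : ∀ x d, R x d =
      (∫ t in Ioi (0:ℝ), f ((x, 0) + t • (u1, u2)))
      + (∫ t in (0:ℝ)..d, f (x + t, 0))
      + ∫ t in Ioi (0:ℝ), f ((x + d, 0) + t • (v1, v2))) :
    ∀ x : ℝ, ftil x = -(u1 * v1 / (u1 + v1)) * deriv (fun x' => R x' 0) x := by
  intro x
  have hcont := hftil_smooth.continuous
  have hR0 : (fun y => R y 0) = fun y =>
      (∫ t in Ioi (0 : ℝ), ftil (y + t * u1)) + ∫ t in Ioi (0 : ℝ), ftil (y + t * v1) := by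
    funext y
    have hray (p q : ℝ) (hq : 0 < q) :
        ∫ t in Ioi (0 : ℝ), f ((y, 0) + t • (p, q)) = ∫ t in Ioi (0 : ℝ), ftil (y + t * p) := by
      refine setIntegral_congr_fun measurableSet_Ioi fun t ht => ?_
      simpa using hf (y + t * p) (t * q) (mul_nonneg (le_of_lt ht) hq.le)
    rw [hR, intervalIntegral.integral_same, add_zero, add_zero, hray u1 u2 hu2_pos,
      hray v1 v2 hv2_pos]
  rw [hR0, ((hasDerivAt_rayIntegral_of_neg hcont hftil_int hu1_neg x).fun_add
    (hasDerivAt_rayIntegral_of_pos hcont hftil_int hv1_pos x)).deriv]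
  have hu1 := hu1_neg.ne
  have hv1 := hv1_pos.ne'
  field_simp
  ring
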